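/- For every integer g ≥ 0, there exists a connected finite simple graph of genus g and gonality exactly ⌊(g + 3)/2⌋. -/

import Mathlib

open SimpleGraph Finset
open scoped Classical

noncomputable section

def lap {V : Type} [Fintype V] (G : SimpleGraph V) (S : V → ℤ) : V → ℤ :=
  fun v => ∑ w : V, if G.Adj v w then S v - S w else 0

def Effective {V : Type} (D : V → ℤ) : Prop := ∀ v, 0 ≤ D v

def degDiv {V : Type} [Fintype V] (D : V → ℤ) : ℤ := ∑ v, D v

def LinEquiv {V : Type} [Fintype V] (G : SimpleGraph V) (D D' : V → ℤ) : Prop :=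
  ∃ S : V → ℤ, D' = D - lap G S

def PosRank {V : Type} [Fintype V] (G : SimpleGraph V) (D : V → ℤ) : Prop :=
  ∀ v : V, ∃ D' : V → ℤ, Effective D' ∧ LinEquiv G D D' ∧ 1 ≤ D' v

def gonality {V : Type} [Fintype V] (G : SimpleGraph V) : ℕ :=
  sInf {n : ℕ | ∃ D : V → ℤ, Effective D ∧ PosRank G D ∧ degDiv D = (n : ℤ)}

def indic {V : Type} (A : Set V) : V → ℤ := fun v => if v ∈ A then 1 else 0

/-! ### Linear equivalence as equality in a quotient group -/

section Laplacian

variable {V : Type} [Fintype V] (G : SimpleGraph V)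

def lapHom : (V → ℤ) →+ (V → ℤ) where
  toFun := lap G
  map_zero' := by ext v; simp [lap]
  map_add' S T := by
    ext v
    simp only [lap, Pi.add_apply, ← Finset.sum_add_distrib]
    refine Finset.sum_congr rfl fun w _ => ?_
    split_ifs <;> ring

abbrev Pic : Type := (V → ℤ) ⧸ (lapHom G).range

def divClass : (V → ℤ) →+ Pic G := QuotientAddGroup.mk' (lapHom G).range

lemma divClass_lap (S : V → ℤ) : divClass G (lap G S) = 0 :=
  (QuotientAddGroup.eq_zero_iff _).2 ⟨S, rfl⟩

lemma linEquiv_of_divClass_eq {D E : V → ℤ} (h : divClass G D = divClass G E) :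
    LinEquiv G D E := by
  have h0 : divClass G (D - E) = 0 := by rw [map_sub, h, sub_self]
  obtain ⟨S, hS⟩ := (QuotientAddGroup.eq_zero_iff _).1 h0
  refine ⟨S, ?_⟩
  change lap G S = D - E at hS
  rw [hS]
  abel

lemma sum_mul_lap_comm (S T : V → ℤ) : ∑ v, S v * lap G T v = ∑ v, T v * lap G S v := by
  have expand (A B : V → ℤ) : ∑ v, A v * lap G B v =
      ∑ v, ∑ w, (if G.Adj v w then A v * B v else 0)
        - ∑ v, ∑ w, (if G.Adj v w then A v * B w else 0) := by
    simp only [lap, Finset.mul_sum, ← Finset.sum_sub_distrib]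
    refine Finset.sum_congr rfl fun v _ => Finset.sum_congr rfl fun w _ => ?_
    split_ifs <;> ring
  rw [expand S T, expand T S]
  congr 1
  · refine Finset.sum_congr rfl fun v _ => Finset.sum_congr rfl fun w _ => ?_
    rw [mul_comm]
  · rw [Finset.sum_comm]
    refine Finset.sum_congr rfl fun v _ => Finset.sum_congr rfl fun w _ => ?_
    rw [G.adj_comm, mul_comm]

end Laplacian

/-! ### Chips and partial degrees on an initial segment of the naturals -/

section Chips

variable {N : ℕ}

def chip (k : ℕ) : Fin N → ℤ := fun v => if v.val = k then 1 else 0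

def below (k : ℕ) : Fin N → ℤ := fun v => if v.val < k then 1 else 0

def degBelow (k : ℕ) (D : Fin N → ℤ) : ℤ := ∑ v, below k v * D v

lemma effective_chip (k : ℕ) : Effective (chip k : Fin N → ℤ) := fun v => by
  unfold chip; split_ifs <;> norm_num

lemma Effective.add {V : Type} {D E : V → ℤ} (hD : Effective D) (hE : Effective E) :
    Effective (D + E) := fun v => add_nonneg (hD v) (hE v)

lemma effective_sum_chip {ι : Type} (s : Finset ι) (f : ι → ℕ) :
    Effective (∑ i ∈ s, chip (f i) : Fin N → ℤ) := fun v => by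
  rw [Finset.sum_apply]
  exact Finset.sum_nonneg fun i _ => effective_chip _ v

lemma sum_mul_chip {k : ℕ} (hk : k < N) (S : Fin N → ℤ) : ∑ v, S v * chip k v = S ⟨k, hk⟩ := by
  rw [Finset.sum_eq_single ⟨k, hk⟩]
  · simp [chip]
  · intro v _ hv
    have : v.val ≠ k := fun h => hv (Fin.ext h)
    simp [chip, this]
  · simp

lemma degDiv_chip {k : ℕ} (hk : k < N) : degDiv (chip k : Fin N → ℤ) = 1 := by
  simpa [degDiv] using sum_mul_chip hk 1

lemma degBelow_mono {D : Fin N → ℤ} (hD : Effective D) {k l : ℕ} (h : k ≤ l) :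
    degBelow k D ≤ degBelow l D := by
  refine Finset.sum_le_sum fun v _ => mul_le_mul_of_nonneg_right ?_ (hD v)
  unfold below
  split_ifs <;> omega

lemma degBelow_zero (D : Fin N → ℤ) : degBelow 0 D = 0 := by simp [degBelow, below]

lemma degBelow_eq_degDiv (D : Fin N → ℤ) : degBelow N D = degDiv D := by
  simp [degBelow, below, degDiv]

lemma degBelow_succ (k : ℕ) (hk : k < N) (D : Fin N → ℤ) :
    degBelow (k + 1) D = degBelow k D + D ⟨k, hk⟩ := by
  rw [← sum_mul_chip hk D, degBelow, degBelow, ← Finset.sum_add_distrib]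
  refine Finset.sum_congr rfl fun v _ => ?_
  unfold below chip
  split_ifs <;> omega

lemma degBelow_sub (k : ℕ) (D E : Fin N → ℤ) :
    degBelow k (D - E) = degBelow k D - degBelow k E := by
  simp [degBelow, mul_sub]

end Chips

/-! ### The chain of cycles -/

/-- A chain of `g` cycles of length `m + 1`: the path `0, 1, …, g * m` together with a chord
joining `j * m` to `(j + 1) * m` for every `j < g`. -/
def cycleChain (g m : ℕ) : SimpleGraph (Fin (g * m + 1)) :=
  SimpleGraph.fromRel fun u v => v.val = u.val + 1 ∨ (m ∣ u.val ∧ v.val = u.val + m)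

section CycleChain

variable {g m : ℕ}

lemma cycleChain_adj (hm : 2 ≤ m) {u v : Fin (g * m + 1)} :
    (cycleChain g m).Adj u v ↔
      (v.val = u.val + 1 ∨ (m ∣ u.val ∧ v.val = u.val + m)) ∨
      (u.val = v.val + 1 ∨ (m ∣ v.val ∧ u.val = v.val + m)) := by
  rw [cycleChain, SimpleGraph.fromRel_adj, and_iff_right_iff_imp]
  rintro h rfl
  omega

lemma cycleChain_connected (hm : 2 ≤ m) : (cycleChain g m).Connected := by
  have h (k : ℕ) (hk : k < g * m + 1) : (cycleChain g m).Reachable 0 ⟨k, hk⟩ := by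
    induction k with
    | zero => exact SimpleGraph.Reachable.refl _
    | succ k ih =>
      refine (ih (by omega)).trans (SimpleGraph.Adj.reachable ?_)
      rw [cycleChain_adj hm]
      simp
  exact ⟨fun u v => (h u u.2).symm.trans (h v v.2)⟩

lemma chord_bound {j : ℕ} (hj : j < g) : j * m + m ≤ g * m := by
  rw [← Nat.succ_mul]
  exact Nat.mul_le_mul_right m hj

def chainEdge (g m : ℕ) : Fin (g * m) ⊕ Fin g → Sym2 (Fin (g * m + 1))
  | Sum.inl i => s(⟨i, by omega⟩, ⟨i + 1, by omega⟩)
  | Sum.inr j => s(⟨j * m, by have := chord_bound (m := m) j.2; omega⟩,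
      ⟨j * m + m, by have := chord_bound (m := m) j.2; omega⟩)

lemma chainEdge_injective (hm : 2 ≤ m) : Function.Injective (chainEdge g m) := by
  rintro (i | i) (j | j) h <;>
    simp only [chainEdge, Sym2.eq_iff, Fin.mk.injEq] at h
  · congr 1; ext; omega
  · omega
  · omega
  · congr 1; ext
    exact Nat.eq_of_mul_eq_mul_right (by omega : 0 < m) (by omega)

lemma range_chainEdge (hm : 2 ≤ m) : Set.range (chainEdge g m) = (cycleChain g m).edgeSet := by
  ext e
  induction e with
  | h u v =>
    rw [SimpleGraph.mem_edgeSet, cycleChain_adj hm]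
    constructor
    · rintro ⟨i | j, h⟩ <;> simp only [chainEdge, Sym2.eq_iff] at h <;>
        obtain ⟨rfl, rfl⟩ | ⟨rfl, rfl⟩ := h <;> simp
    · have key (u v : Fin (g * m + 1))
          (h : v.val = u.val + 1 ∨ (m ∣ u.val ∧ v.val = u.val + m)) :
          s(u, v) ∈ Set.range (chainEdge g m) := by
        rcases h with h | ⟨⟨j, hj⟩, h⟩
        · exact ⟨Sum.inl ⟨u, by omega⟩, by simp [chainEdge, ← h]⟩
        · have hu : u.val = j * m := by rw [hj, mul_comm]
          have hjg : j < g := by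
            refine Nat.lt_of_mul_lt_mul_right (a := m) ?_
            omega
          exact ⟨Sum.inr ⟨j, hjg⟩, by simp [chainEdge, ← hu, ← h]⟩
      rintro (h | h)
      · exact key u v h
      · rw [Sym2.eq_swap]
        exact key v u h

lemma card_edgeFinset_cycleChain (hm : 2 ≤ m) :
    (cycleChain g m).edgeFinset.card = g * m + g := by
  have : (cycleChain g m).edgeFinset = Finset.univ.map ⟨_, chainEdge_injective hm⟩ := by
    ext e
    rw [SimpleGraph.mem_edgeFinset, ← range_chainEdge hm]
    simp
  rw [this]
  simp

/-- Firing the vertices `≤ j * m + i` sends one chip along the path edge leaving this set and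
one chip along the `j`-th chord. -/
lemma lap_below (hm : 2 ≤ m) {j i : ℕ} (hj : j < g) (hi : i < m) :
    lap (cycleChain g m) (below (j * m + i + 1)) =
      chip (j * m + i) - chip (j * m + i + 1) + chip (j * m) - chip (j * m + m) := by
  have hb := chord_bound (m := m) hj
  ext v
  have chord (x : ℕ) (h : m ∣ x) (h1 : x ≤ j * m + i) (h2 : j * m + i < x + m) : x = j * m := by
    obtain ⟨k, rfl⟩ := h
    have h3 : k < j + 1 := Nat.lt_of_mul_lt_mul_left (a := m) (by linarith)
    have h4 : j < k + 1 := Nat.lt_of_mul_lt_mul_left (a := m) (by linarith)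
    rw [show k = j by omega, mul_comm]
  have hdvd : m ∣ j * m := Dvd.intro_left j rfl
  have term (w : Fin (g * m + 1)) :
      (if (cycleChain g m).Adj v w then
        (below (j * m + i + 1) v - below (j * m + i + 1) w : ℤ) else 0) =
      chip (j * m + i) v * chip (j * m + i + 1) w - chip (j * m + i + 1) v * chip (j * m + i) w
        + chip (j * m) v * chip (j * m + m) w - chip (j * m + m) v * chip (j * m) w := by
    rw [cycleChain_adj hm]
    have hv := chord v
    have hw := chord w
    have hv' : v.val = j * m → m ∣ v.val := fun h => h ▸ hdvd
    have hw' : w.val = j * m → m ∣ w.val := fun h => h ▸ hdvd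
    generalize j * m = a at *
    simp only [below, chip, ite_zero_mul_ite_zero, mul_one]
    by_cases hdv : m ∣ v.val <;> by_cases hdw : m ∣ w.val <;>
      simp only [hdv, hdw, true_and, false_and, or_false, forall_const,
        imp_false] at hv hw hv' hw' ⊢ <;>
      split_ifs <;> omega
  have one {k : ℕ} (hk : k ≤ g * m) (c : ℤ) :
      ∑ w : Fin (g * m + 1), c * chip k w = c :=
    sum_mul_chip (Nat.lt_succ_of_le hk) fun _ => c
  simp only [lap, term, Finset.sum_add_distrib, Finset.sum_sub_distrib, Pi.sub_apply,
    Pi.add_apply]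
  rw [one (by omega), one (by omega), one (by omega), one (by omega)]

/-! ### The lower bound -/

lemma degDiv_lap {V : Type} [Fintype V] (G : SimpleGraph V) (S : V → ℤ) :
    degDiv (lap G S) = 0 := by
  have h := sum_mul_lap_comm G 1 S
  have h1 : lap G 1 = 0 := by ext v; simp [lap]
  simpa [h1, degDiv] using h

lemma degBelow_lap (hm : 2 ≤ m) {j i : ℕ} (hj : j < g) (hi : i < m) (S : Fin (g * m + 1) → ℤ) :
    degBelow (j * m + i + 1) (lap (cycleChain g m) S) =
      ∑ v, S v * chip (j * m + i) v - ∑ v, S v * chip (j * m + i + 1) v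
        + ∑ v, S v * chip (j * m) v - ∑ v, S v * chip (j * m + m) v := by
  rw [degBelow, sum_mul_lap_comm, lap_below hm hj hi]
  simp only [Pi.sub_apply, Pi.add_apply, mul_add, mul_sub, Finset.sum_add_distrib,
    Finset.sum_sub_distrib]

/-- The position of a divisor on the `j`-th cycle, modulo the length of that cycle, only depends
on its class. -/
lemma dvd_sum_degBelow_lap (hm : 2 ≤ m) {j : ℕ} (hj : j < g) (S : Fin (g * m + 1) → ℤ) :
    (m + 1 : ℤ) ∣ ∑ i ∈ Finset.range m, degBelow (j * m + i + 1) (lap (cycleChain g m) S) := by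
  refine ⟨∑ v, S v * chip (j * m) v - ∑ v, S v * chip (j * m + m) v, ?_⟩
  rw [Finset.sum_congr rfl fun i hi => degBelow_lap hm hj (Finset.mem_range.1 hi) S]
  have tel := Finset.sum_range_sub' (fun i => ∑ v, S v * chip (j * m + i) v) m
  simp only [← add_assoc, add_zero] at tel
  simp only [add_sub_assoc (_ - _)]
  rw [Finset.sum_add_distrib, tel, Finset.sum_const, Finset.card_range, nsmul_eq_mul]
  ring

lemma exists_min_of_lower_bound {α : Type} {p : α → Prop} (hp : ∃ a, p a) (f : α → ℤ) {c : ℤ}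
    (hf : ∀ a, p a → c ≤ f a) : ∃ a, p a ∧ ∀ b, p b → f a ≤ f b := by
  obtain ⟨a, ha⟩ := hp
  obtain ⟨x, ⟨b, hb, rfl⟩, hx⟩ := Int.exists_least_of_bdd (P := fun x => ∃ a, p a ∧ f a = x)
    ⟨c, by rintro _ ⟨a, ha, rfl⟩; exact hf a ha⟩ ⟨f a, a, ha, rfl⟩
  exact ⟨b, hb, fun a ha => hx _ ⟨a, ha, rfl⟩⟩

lemma le_degDiv_of_posRank (hm : 2 ≤ m) {D : Fin (g * m + 1) → ℤ}
    (hD : PosRank (cycleChain g m) D) (hdm : degDiv D ≤ m) : g + 2 ≤ 2 * degDiv D := by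
  let p : (Fin (g * m + 1) → ℤ) → Prop := fun E => Effective E ∧ LinEquiv (cycleChain g m) D E
  have hp : ∃ E, p E := by
    obtain ⟨E, h1, h2, -⟩ := hD 0
    exact ⟨E, h1, h2⟩
  have total (E) (hE : p E) : degBelow (g * m + 1) E = degDiv D := by
    obtain ⟨-, S, rfl⟩ := hE
    rw [degBelow_sub, degBelow_eq_degDiv, degBelow_eq_degDiv, degDiv_lap, sub_zero]
  have lower (k E) (hE : p E) : 0 ≤ degBelow k E := by
    rw [← degBelow_zero E]
    exact degBelow_mono hE.1 (Nat.zero_le k)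
  have upper (k E) (hk : k ≤ g * m + 1) (hE : p E) : degBelow k E ≤ degDiv D := by
    rw [← total E hE]
    exact degBelow_mono hE.1 hk
  have hjm (j : ℕ) (hj : j ≤ g) : j * m ≤ g * m := Nat.mul_le_mul_right m hj
  choose A hA hAmin using fun j : ℕ =>
    exists_min_of_lower_bound hp (fun E => degBelow (j * m) E) fun E hE => lower (j * m) E hE
  have hmax (j : ℕ) : ∃ E, p E ∧
      (j ≤ g → ∀ F, p F → degBelow (j * m + 1) F ≤ degBelow (j * m + 1) E) := by
    by_cases hj : j ≤ g
    · have := hjm j hj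
      obtain ⟨E, hE, h⟩ := exists_min_of_lower_bound hp (fun E => -degBelow (j * m + 1) E)
        fun E hE => neg_le_neg (upper (j * m + 1) E (by omega) hE)
      exact ⟨E, hE, fun _ F hF => neg_le_neg_iff.1 (h F hF)⟩
    · exact ⟨hp.choose, hp.choose_spec, fun h => absurd h hj⟩
  choose B hB hBmax using hmax
  have gap (j : ℕ) (hj : j ≤ g) : degBelow (j * m) (A j) + 1 ≤ degBelow (j * m + 1) (B j) := by
    have hlt : j * m < g * m + 1 := Nat.lt_succ_of_le (hjm j hj)
    obtain ⟨E, h1, h2, h3⟩ := hD ⟨j * m, hlt⟩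
    have h4 := hAmin j E ⟨h1, h2⟩
    have h5 := hBmax j hj E ⟨h1, h2⟩
    rw [degBelow_succ _ hlt] at h5
    linarith
  have key (j : ℕ) (hj : j ≤ g) :
      (j : ℤ) + 1 ≤ degBelow (j * m) (A j) + degBelow (j * m + 1) (B j) := by
    induction j with
    | zero =>
      have h1 := gap 0 hj
      have h2 := lower (0 * m) _ (hA 0)
      push_cast
      linarith
    | succ j ih =>
      have hjg : j < g := hj
      have hb := chord_bound (m := m) hjg
      by_contra! hlt
      have ih := ih hjg.le
      have hAj := hA (j + 1)
      have hAk := hAmin j _ hAj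
      have hBj := hB j
      have hBk := hBmax (j + 1) hj _ hBj
      push_cast at hlt
      rw [Nat.succ_mul] at hBk hlt
      have e1 := degBelow_mono hAj.1 (show j * m ≤ j * m + m by omega)
      have e2 := degBelow_mono hBj.1 (show j * m + 1 ≤ j * m + m + 1 by omega)
      obtain ⟨-, S, hS⟩ := id hAj
      obtain ⟨-, T, hT⟩ := id hBj
      have dvd : (m + 1 : ℤ) ∣ ∑ i ∈ Finset.range m,
          (degBelow (j * m + i + 1) (B j) - degBelow (j * m + i + 1) (A (j + 1))) := by
        have h := dvd_sub (dvd_sum_degBelow_lap hm hjg S) (dvd_sum_degBelow_lap hm hjg T)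
        rw [← Finset.sum_sub_distrib] at h
        refine h.trans (dvd_of_eq (Finset.sum_congr rfl fun i _ => ?_))
        rw [hS, hT, degBelow_sub, degBelow_sub]
        ring
      rw [Finset.sum_congr rfl (g := fun _ =>
        degBelow (j * m + 1) (B j) - degBelow (j * m) (A j)) ?_, Finset.sum_const,
        Finset.card_range, nsmul_eq_mul] at dvd
      · have h1 := gap j hjg.le
        have h2 := lower (j * m) _ (hA j)
        have h3 := upper (j * m + 1) _ (by omega) hBj
        have dvd' : (m + 1 : ℤ) ∣ degBelow (j * m + 1) (B j) - degBelow (j * m) (A j) :=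
          IsCoprime.dvd_of_dvd_mul_left ⟨1, -1, by ring⟩ dvd
        have := Int.le_of_dvd (by linarith) dvd'
        linarith
      · intro i hi
        rw [Finset.mem_range] at hi
        have f1 := degBelow_mono hAj.1 (show j * m ≤ j * m + i + 1 by omega)
        have f2 := degBelow_mono hAj.1 (show j * m + i + 1 ≤ j * m + m by omega)
        have f3 := degBelow_mono hBj.1 (show j * m + 1 ≤ j * m + i + 1 by omega)
        have f4 := degBelow_mono hBj.1 (show j * m + i + 1 ≤ j * m + m + 1 by omega)
        linarith
  have h1 := key g le_rfl
  have h2 := gap g le_rfl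
  have h3 := upper (g * m + 1) _ le_rfl (hB g)
  linarith

/-! ### The upper bound -/

lemma divClass_chip_add (hm : 2 ≤ m) {j : ℕ} (hj : j < g) {i : ℕ} (hi : i ≤ m) :
    divClass (cycleChain g m) (chip (j * m + i)) = divClass (cycleChain g m) (chip (j * m))
      - i • (divClass (cycleChain g m) (chip (j * m + m))
        - divClass (cycleChain g m) (chip (j * m))) := by
  induction i with
  | zero => simp
  | succ i ih =>
    have h := divClass_lap (cycleChain g m) (below (j * m + i + 1))
    rw [lap_below hm hj hi, map_sub, map_add, map_sub, ih (by omega)] at h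
    rw [← add_assoc, ← sub_eq_zero, ← neg_eq_zero, ← h, succ_nsmul]
    abel

lemma two_chips_right (hm : 2 ≤ m) {j : ℕ} (hj : j < g) {i l : ℕ} (h : i + l + 1 = m) :
    divClass (cycleChain g m) (chip (j * m + m) + chip (j * m + m)) =
      divClass (cycleChain g m) (chip (j * m + i) + chip (j * m + l)) := by
  have h1 := divClass_chip_add hm hj (le_refl m)
  rw [map_add, map_add, divClass_chip_add hm hj (show i ≤ m by omega),
    divClass_chip_add hm hj (show l ≤ m by omega)]
  subst h
  linear_combination (norm := module) h1

lemma two_chips_left (hm : 2 ≤ m) {j : ℕ} (hj : j < g) {i l : ℕ} (h : i + l = m + 1)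
    (hi : i ≤ m) (hl : l ≤ m) :
    divClass (cycleChain g m) (chip (j * m) + chip (j * m)) =
      divClass (cycleChain g m) (chip (j * m + i) + chip (j * m + l)) := by
  have h1 := divClass_chip_add hm hj (le_refl m)
  rw [map_add, map_add, divClass_chip_add hm hj hi, divClass_chip_add hm hj hl]
  have h2 : (i + l) • (divClass (cycleChain g m) (chip (j * m + m))
      - divClass (cycleChain g m) (chip (j * m))) = 0 := by
    rw [h]
    linear_combination (norm := module) h1
  linear_combination (norm := module) h2

def chainDivisor (g m : ℕ) : Fin (g * m + 1) → ℤ :=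
  chip 0 + ∑ t ∈ Finset.range ((g + 1) / 2), chip (2 * t * m + (m - 1))

lemma effective_chainDivisor : Effective (chainDivisor g m) :=
  (effective_chip 0).add (effective_sum_chip _ _)

lemma degDiv_chainDivisor (hm : 2 ≤ m) : degDiv (chainDivisor g m) = ((g + 3) / 2 : ℕ) := by
  have h (t : ℕ) (ht : t ∈ Finset.range ((g + 1) / 2)) :
      degDiv (chip (2 * t * m + (m - 1)) : Fin (g * m + 1) → ℤ) = 1 := by
    rw [Finset.mem_range] at ht
    have := chord_bound (g := g) (m := m) (show 2 * t < g by omega)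
    exact degDiv_chip (by omega)
  have h0 : degDiv (chip 0 : Fin (g * m + 1) → ℤ) = 1 := degDiv_chip (by omega)
  unfold degDiv at *
  simp only [chainDivisor, Pi.add_apply, Finset.sum_apply, Finset.sum_add_distrib]
  rw [Finset.sum_comm, Finset.sum_congr rfl h, h0]
  simp only [Finset.sum_const, Finset.card_range, nsmul_eq_mul, mul_one]
  omega

lemma divClass_initial (hm : 2 ≤ m) {i : ℕ} (hi : 2 * i ≤ g) :
    divClass (cycleChain g m) (chip 0 + ∑ t ∈ Finset.range i, chip (2 * t * m + (m - 1))) =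
      divClass (cycleChain g m)
        (chip (2 * i * m) + ∑ t ∈ Finset.range i, chip ((2 * t + 1) * m + 1)) := by
  induction i with
  | zero => simp
  | succ i ih =>
    have h1 := two_chips_right hm (show 2 * i < g by omega) (i := 0) (l := m - 1) (by omega)
    have h2 := two_chips_left hm (show 2 * i + 1 < g by omega) (i := 1) (l := m)
      (by omega) (by omega) le_rfl
    have ih := ih (by omega)
    rw [Finset.sum_range_succ, Finset.sum_range_succ]
    rw [show 2 * i * m + m = (2 * i + 1) * m by ring, add_zero] at h1
    rw [show (2 * i + 1) * m + m = 2 * (i + 1) * m by ring] at h2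
    simp only [map_add] at *
    linear_combination (norm := module) ih - h1 + h2

/-- `chainDivisor` is equivalent to an effective divisor with two chips at the common vertex of
the cycles `2 * i` and `2 * i + 1`. -/
lemma exists_two_chips (hm : 2 ≤ m) {i : ℕ} (hi : 2 * i < g) :
    ∃ F : Fin (g * m + 1) → ℤ, Effective F ∧
      divClass (cycleChain g m) (chainDivisor g m) = divClass (cycleChain g m)
        (chip ((2 * i + 1) * m) + chip ((2 * i + 1) * m) + F) := by
  refine ⟨∑ t ∈ Finset.range i, chip ((2 * t + 1) * m + 1)
    + ∑ t ∈ Finset.Ico (i + 1) ((g + 1) / 2), chip (2 * t * m + (m - 1)),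
    (effective_sum_chip _ _).add (effective_sum_chip _ _), ?_⟩
  have h1 := two_chips_right hm hi (i := 0) (l := m - 1) (by omega)
  rw [show 2 * i * m + m = (2 * i + 1) * m by ring, add_zero] at h1
  have h2 := divClass_initial hm hi.le
  rw [chainDivisor, ← Finset.sum_range_add_sum_Ico _ (show i + 1 ≤ (g + 1) / 2 by omega),
    Finset.sum_range_succ]
  simp only [map_add] at *
  linear_combination (norm := module) h2 - h1

lemma posRank_chainDivisor (hm : 2 ≤ m) : PosRank (cycleChain g m) (chainDivisor g m) := by
  intro w
  suffices h : ∃ (F : Fin (g * m + 1) → ℤ), Effective F ∧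
      divClass (cycleChain g m) (chainDivisor g m) =
        divClass (cycleChain g m) (chip w.val + F) by
    obtain ⟨F, hF, h⟩ := h
    refine ⟨chip w.val + F, (effective_chip _).add hF, linEquiv_of_divClass_eq _ h, ?_⟩
    have := hF w
    simpa [chip] using this
  rcases Nat.eq_zero_or_pos w.val with hw | hw
  · exact ⟨_, effective_sum_chip _ _, by rw [hw, chainDivisor]⟩
  obtain ⟨j, r, hr, hr', hwjr⟩ : ∃ j r, 1 ≤ r ∧ r ≤ m ∧ w.val = j * m + r := by
    refine ⟨(w.val - 1) / m, (w.val - 1) % m + 1, by omega,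
      Nat.mod_lt _ (by omega), ?_⟩
    have := Nat.div_add_mod' (w.val - 1) m
    omega
  have hj : j < g := Nat.lt_of_mul_lt_mul_right (a := m) (by omega)
  rw [hwjr]
  obtain ⟨i, rfl | rfl⟩ := Nat.even_or_odd' j
  · obtain ⟨F, hF, h⟩ := exists_two_chips hm hj
    rw [add_one_mul] at h
    rcases hr'.eq_or_lt with rfl | hlt
    · exact ⟨_, (effective_chip _).add hF, by rw [h, add_assoc]⟩
    · refine ⟨chip (2 * i * m + (m - 1 - r)) + F, (effective_chip _).add hF, ?_⟩
      rw [h, ← add_assoc, map_add, two_chips_right hm hj (i := r) (l := m - 1 - r) (by omega),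
        ← map_add]
  · obtain ⟨F, hF, h⟩ := exists_two_chips hm (show 2 * i < g by omega)
    refine ⟨chip ((2 * i + 1) * m + (m + 1 - r)) + F, (effective_chip _).add hF, ?_⟩
    rw [h, ← add_assoc, map_add, two_chips_left hm hj (i := r) (l := m + 1 - r)
      (by omega) hr' (by omega), ← map_add]

end CycleChain

/-- For every integer `g ≥ 0` there exists a connected graph of genus `g`
(i.e. with `|E| - |V| + 1 = g`) and gonality exactly `⌊(g + 3)/2⌋`. -/
theorem stmt_15 (g : ℕ) :
    ∃ (n : ℕ) (G : SimpleGraph (Fin n)),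
      G.Connected ∧ G.edgeFinset.card + 1 = g + n ∧ gonality G = (g + 3) / 2 := by
  have hm : 2 ≤ g + 2 := by omega
  refine ⟨g * (g + 2) + 1, cycleChain g (g + 2), cycleChain_connected hm, ?_, ?_⟩
  · rw [card_edgeFinset_cycleChain hm]
    ring
  · refine IsLeast.csInf_eq ⟨⟨chainDivisor g (g + 2), effective_chainDivisor,
      posRank_chainDivisor hm, degDiv_chainDivisor hm⟩, ?_⟩
    rintro n ⟨D, -, hD, hn⟩
    by_contra! hlt
    have := le_degDiv_of_posRank hm hD (by omega)
    omega
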